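/- Let q0 ∈ ℓ^{2,1}(ℤ,ℂ). Then the initial-value problem for the focusing Ablowitz–Ladik system, i (d/dt) q_n(t) = q_{n+1}(t) − 2 q_n(t) + q_{n−1}(t) + |q_n(t)|²(q_{n+1}(t) + q_{n−1}(t)) for all n ∈ ℤ, with q_n(0) = (q0)_n, has a solution q : ℝ → ℓ^{2,1}(ℤ,ℂ) defined for all t ∈ ℝ; this solution is unique among continuous curves ℝ → ℓ^∞(ℤ,ℂ) whose components are differentiable in t and satisfy the system; moreover, on every compact interval of ℝ the map t ↦ q(t) is Lipschitz continuous into ℓ^{2,1}. -/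

import Mathlib

open scoped ENNReal

/-- The right-hand side of the focusing Ablowitz–Ladik system, written as
`q' = alRHS q`, i.e. `i q'_n = q_{n+1} - 2 q_n + q_{n-1} + |q_n|² (q_{n+1} + q_{n-1})`. -/
noncomputable def alRHS (q : ℤ → ℂ) (n : ℤ) : ℂ :=
  -Complex.I * (q (n + 1) - 2 * q n + q (n - 1) +
    (‖q n‖ : ℂ) ^ 2 * (q (n + 1) + q (n - 1)))

/-- The ℓ^{2,1} norm of a sequence. -/
noncomputable def norm21 (a : ℤ → ℂ) : ℝ :=
  Real.sqrt (∑' n : ℤ, (1 + (n : ℝ) ^ 2) * ‖a n‖ ^ 2)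

/-- The unweighted Hilbert space in which the rescaled sequences live. -/
abbrev ALE : Type := lp (fun _ : ℤ => ℂ) 2

/-- The weight. -/
noncomputable def wt (n : ℤ) : ℝ := Real.sqrt (1 + (n : ℝ) ^ 2)

lemma wt_sq (n : ℤ) : wt n ^ 2 = 1 + (n : ℝ) ^ 2 := Real.sq_sqrt (by positivity)

lemma wt_pos (n : ℤ) : 0 < wt n := Real.sqrt_pos.2 (by positivity)

lemma one_le_wt (n : ℤ) : 1 ≤ wt n := by
  have h := wt_sq n
  nlinarith [wt_pos n, sq_nonneg (n : ℝ)]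

lemma abs_le_wt (n : ℤ) : |(n : ℝ)| ≤ wt n := by
  apply abs_le_of_sq_le_sq _ (wt_pos n).le
  rw [wt_sq]; linarith

lemma wt_le_succ (n : ℤ) : wt n ≤ 2 * wt (n + 1) := by
  apply le_of_sq_le_sq _ (by have := wt_pos (n + 1); positivity)
  rw [mul_pow, wt_sq, wt_sq]; push_cast
  nlinarith [sq_nonneg ((n : ℝ) + 2), sq_nonneg ((n : ℝ) + 1)]

lemma wt_le_pred (n : ℤ) : wt n ≤ 2 * wt (n - 1) := by
  apply le_of_sq_le_sq _ (by have := wt_pos (n - 1); positivity)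
  rw [mul_pow, wt_sq, wt_sq]; push_cast
  nlinarith [sq_nonneg ((n : ℝ) - 2), sq_nonneg ((n : ℝ) - 1)]

lemma ale_hasSum (x : ALE) : HasSum (fun n => ‖x n‖ ^ 2) (‖x‖ ^ 2) := by
  have := lp.hasSum_norm (p := 2) (by norm_num) x
  simpa using this

lemma ale_mem {f : ℤ → ℂ} (h : Summable fun n => ‖f n‖ ^ 2) :
    Memℓp (E := fun _ : ℤ => ℂ) f 2 := by
  apply memℓp_gen
  simpa using h

lemma ale_apply_le (x : ALE) (n : ℤ) : ‖x n‖ ≤ ‖x‖ :=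
  lp.norm_apply_le_norm (by norm_num) x n

lemma three_term_real (G f : ℤ → ℝ) (S c : ℝ) (h0 : HasSum (fun n => G n ^ 2) (S ^ 2))
    (hf : ∀ n, 0 ≤ f n) (h : ∀ n, f n ≤ c * (G (n + 1) + G n + G (n - 1))) :
    (Summable fun n => f n ^ 2) ∧ ∑' n, f n ^ 2 ≤ (3 * c * S) ^ 2 := by
  have h1 : HasSum (fun n : ℤ => G (n + 1) ^ 2) (S ^ 2) := by
    have := (Equiv.addRight (1 : ℤ)).hasSum_iff.2 h0
    simpa only [Function.comp_def, Equiv.coe_addRight] using this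
  have h2 : HasSum (fun n : ℤ => G (n - 1) ^ 2) (S ^ 2) := by
    have := (Equiv.subRight (1 : ℤ)).hasSum_iff.2 h0
    simpa only [Function.comp_def, Equiv.subRight_apply] using this
  have h3 := ((h1.add h0).add h2).mul_left (3 * c ^ 2)
  have hb : ∀ n, f n ^ 2 ≤ 3 * c ^ 2 * (G (n + 1) ^ 2 + G n ^ 2 + G (n - 1) ^ 2) := by
    intro n
    have h4 : f n ^ 2 ≤ (c * (G (n + 1) + G n + G (n - 1))) ^ 2 :=
      pow_le_pow_left₀ (hf n) (h n) 2
    have h5 : (G (n + 1) + G n + G (n - 1)) ^ 2 ≤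
        3 * (G (n + 1) ^ 2 + G n ^ 2 + G (n - 1) ^ 2) := by
      nlinarith [sq_nonneg (G (n + 1) - G n), sq_nonneg (G (n + 1) - G (n - 1)),
        sq_nonneg (G n - G (n - 1))]
    calc _ ≤ _ := h4
      _ = c ^ 2 * (G (n + 1) + G n + G (n - 1)) ^ 2 := by ring
      _ ≤ c ^ 2 * (3 * (G (n + 1) ^ 2 + G n ^ 2 + G (n - 1) ^ 2)) := by gcongr
      _ = _ := by ring
  have hs : Summable fun n => f n ^ 2 :=
    Summable.of_nonneg_of_le (fun n => by positivity) hb h3.summable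
  refine ⟨hs, ?_⟩
  have h6 := hasSum_le hb hs.hasSum h3
  have h7 : 3 * c ^ 2 * (S ^ 2 + S ^ 2 + S ^ 2) = (3 * c * S) ^ 2 := by ring
  rwa [h7] at h6

lemma three_term (g : ALE) (f : ℤ → ℂ) (c : ℝ)
    (h : ∀ n, ‖f n‖ ≤ c * (‖g (n + 1)‖ + ‖g n‖ + ‖g (n - 1)‖)) :
    (Summable fun n => ‖f n‖ ^ 2) ∧ ∑' n, ‖f n‖ ^ 2 ≤ (3 * c * ‖g‖) ^ 2 :=
  three_term_real (fun n => ‖g n‖) (fun n => ‖f n‖) ‖g‖ c (ale_hasSum g)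
    (fun _ => norm_nonneg _) h

lemma alRHS_zero (n : ℤ) : alRHS (fun _ => 0) n = 0 := by simp [alRHS]

lemma alRHS_diff (p q : ℤ → ℂ) (a : ℝ) (hp : ∀ n, ‖p n‖ ≤ a) (hq : ∀ n, ‖q n‖ ≤ a) (n : ℤ) :
    ‖alRHS p n - alRHS q n‖ ≤ (2 + 4 * a ^ 2) *
      (‖p (n + 1) - q (n + 1)‖ + ‖p n - q n‖ + ‖p (n - 1) - q (n - 1)‖) := by
  have ha : 0 ≤ a := (norm_nonneg _).trans (hp 0)
  have key : alRHS p n - alRHS q n = -Complex.I *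
      ((1 + (‖p n‖ : ℂ) ^ 2) * (p (n + 1) - q (n + 1))
        + (1 + (‖p n‖ : ℂ) ^ 2) * (p (n - 1) - q (n - 1))
        - 2 * (p n - q n)
        + (((‖p n‖ - ‖q n‖) * (‖p n‖ + ‖q n‖) : ℝ) : ℂ) * (q (n + 1) + q (n - 1))) := by
    simp only [alRHS]; push_cast; ring
  have e1 : ‖(1 + (‖p n‖ : ℂ) ^ 2)‖ ≤ 1 + a ^ 2 := by
    refine (norm_add_le _ _).trans ?_
    simp only [norm_one, norm_pow, Complex.norm_real, norm_norm]
    have := hp n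
    gcongr
  have e2 : ‖(((‖p n‖ - ‖q n‖) * (‖p n‖ + ‖q n‖) : ℝ) : ℂ)‖ ≤ ‖p n - q n‖ * (2 * a) := by
    rw [Complex.norm_real, norm_mul, Real.norm_eq_abs, Real.norm_eq_abs]
    have h1 := abs_norm_sub_norm_le (p n) (q n)
    have h2 : |‖p n‖ + ‖q n‖| ≤ 2 * a := by
      rw [abs_of_nonneg (by positivity)]; linarith [hp n, hq n]
    gcongr
  have e3 : ‖q (n + 1) + q (n - 1)‖ ≤ 2 * a := by
    linarith [norm_add_le (q (n + 1)) (q (n - 1)), hq (n + 1), hq (n - 1)]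
  rw [key, norm_mul, norm_neg, Complex.norm_I, one_mul]
  set A := ‖p (n + 1) - q (n + 1)‖ with hA
  set B := ‖p (n - 1) - q (n - 1)‖ with hB
  set D := ‖p n - q n‖ with hD
  have f1 : ‖(1 + (‖p n‖ : ℂ) ^ 2) * (p (n + 1) - q (n + 1))‖ ≤ (1 + a ^ 2) * A := by
    rw [norm_mul]; gcongr
  have f2 : ‖(1 + (‖p n‖ : ℂ) ^ 2) * (p (n - 1) - q (n - 1))‖ ≤ (1 + a ^ 2) * B := by
    rw [norm_mul]; gcongr
  have f3 : ‖2 * (p n - q n)‖ = 2 * D := by rw [norm_mul]; simp [hD]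
  have f4 : ‖(((‖p n‖ - ‖q n‖) * (‖p n‖ + ‖q n‖) : ℝ) : ℂ) * (q (n + 1) + q (n - 1))‖
      ≤ (D * (2 * a)) * (2 * a) := by
    rw [norm_mul]; gcongr
  have g1 := norm_add_le ((1 + (‖p n‖ : ℂ) ^ 2) * (p (n + 1) - q (n + 1))
        + (1 + (‖p n‖ : ℂ) ^ 2) * (p (n - 1) - q (n - 1))
        - 2 * (p n - q n)) ((((‖p n‖ - ‖q n‖) * (‖p n‖ + ‖q n‖) : ℝ) : ℂ) * (q (n + 1) + q (n - 1)))
  have g2 := norm_sub_le ((1 + (‖p n‖ : ℂ) ^ 2) * (p (n + 1) - q (n + 1))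
        + (1 + (‖p n‖ : ℂ) ^ 2) * (p (n - 1) - q (n - 1))) (2 * (p n - q n))
  have g3 := norm_add_le ((1 + (‖p n‖ : ℂ) ^ 2) * (p (n + 1) - q (n + 1)))
        ((1 + (‖p n‖ : ℂ) ^ 2) * (p (n - 1) - q (n - 1)))
  have hA0 : 0 ≤ A := norm_nonneg _
  have hB0 : 0 ≤ B := norm_nonneg _
  have hD0 : 0 ≤ D := norm_nonneg _
  have i1 : 0 ≤ a ^ 2 * A := by positivity
  have i2 : 0 ≤ a ^ 2 * B := by positivity
  nlinarith

/-- The sequence represented by an element of `ALE`. -/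
noncomputable def qof (x : ALE) (n : ℤ) : ℂ := x n / (wt n : ℂ)

lemma qof_zero : qof 0 = fun _ => 0 := by
  funext n; simp [qof]

lemma wt_mul_qof (x : ALE) (n : ℤ) : wt n * ‖qof x n‖ = ‖x n‖ := by
  have := wt_pos n
  rw [qof, norm_div, Complex.norm_real, Real.norm_of_nonneg this.le]
  field_simp

lemma qof_sub (x y : ALE) (n : ℤ) : qof (x - y) n = qof x n - qof y n := by
  simp [qof, sub_div]

lemma qof_le (x : ALE) (n : ℤ) : ‖qof x n‖ ≤ ‖x‖ := by
  have h1 := wt_mul_qof x n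
  have h2 := one_le_wt n
  have h3 := ale_apply_le x n
  nlinarith [norm_nonneg (qof x n)]

lemma weighted_diff (x y : ALE) (a : ℝ) (hx : ∀ n, ‖qof x n‖ ≤ a) (hy : ∀ n, ‖qof y n‖ ≤ a)
    (n : ℤ) :
    ‖(wt n : ℂ) * alRHS (qof x) n - (wt n : ℂ) * alRHS (qof y) n‖ ≤ (4 + 8 * a ^ 2) *
      (‖(x - y) (n + 1)‖ + ‖(x - y) n‖ + ‖(x - y) (n - 1)‖) := by
  have h := alRHS_diff (qof x) (qof y) a hx hy n
  rw [← mul_sub, norm_mul, Complex.norm_real, Real.norm_of_nonneg (wt_pos n).le]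
  rw [← wt_mul_qof, ← wt_mul_qof, ← wt_mul_qof, qof_sub, qof_sub, qof_sub]
  have w0 := wt_pos n
  have w1 := wt_le_succ n
  have w2 := wt_le_pred n
  calc _ ≤ wt n * ((2 + 4 * a ^ 2) * (‖qof x (n + 1) - qof y (n + 1)‖ + ‖qof x n - qof y n‖
        + ‖qof x (n - 1) - qof y (n - 1)‖)) := by gcongr
    _ = (2 + 4 * a ^ 2) * (wt n * ‖qof x (n + 1) - qof y (n + 1)‖ + wt n * ‖qof x n - qof y n‖
        + wt n * ‖qof x (n - 1) - qof y (n - 1)‖) := by ring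
    _ ≤ (2 + 4 * a ^ 2) * ((2 * wt (n + 1)) * ‖qof x (n + 1) - qof y (n + 1)‖
        + (2 * wt n) * ‖qof x n - qof y n‖
        + (2 * wt (n - 1)) * ‖qof x (n - 1) - qof y (n - 1)‖) := by
      gcongr; linarith
    _ = _ := by ring

lemma field_mem (x : ALE) :
    Memℓp (E := fun _ : ℤ => ℂ) (fun n => (wt n : ℂ) * alRHS (qof x) n) 2 := by
  apply ale_mem
  refine (three_term x _ (4 + 8 * ‖x‖ ^ 2) (fun n => ?_)).1
  have := weighted_diff x 0 ‖x‖ (qof_le x) (by intro n; rw [qof_zero]; simp) n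
  rw [qof_zero, alRHS_zero] at this
  simpa using this

/-- The vector field. -/
noncomputable def alV (x : ALE) : ALE := ⟨fun n => (wt n : ℂ) * alRHS (qof x) n, field_mem x⟩

lemma alV_apply (x : ALE) (n : ℤ) : alV x n = (wt n : ℂ) * alRHS (qof x) n := rfl

lemma alV_zero : alV 0 = 0 := by
  ext n
  rw [alV_apply, qof_zero, alRHS_zero]; simp

lemma alV_diff (x y : ALE) (a : ℝ) (hx : ∀ n, ‖qof x n‖ ≤ a) (hy : ∀ n, ‖qof y n‖ ≤ a) :
    ‖alV x - alV y‖ ≤ 3 * (4 + 8 * a ^ 2) * ‖x - y‖ := by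
  have h := three_term (x - y) (alV x - alV y : ALE) (4 + 8 * a ^ 2)
    (fun n => by
      have := weighted_diff x y a hx hy n
      simpa [alV_apply] using this)
  have h1 := ale_hasSum (alV x - alV y)
  rw [h1.tsum_eq] at h
  exact le_of_sq_le_sq h.2 (by positivity)

lemma alV_le (x : ALE) (a : ℝ) (hx : ∀ n, ‖qof x n‖ ≤ a) :
    ‖alV x‖ ≤ 3 * (4 + 8 * a ^ 2) * ‖x‖ := by
  have ha : 0 ≤ a := (norm_nonneg _).trans (hx 0)
  have := alV_diff x 0 a hx (by intro n; rw [qof_zero]; simpa using ha)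
  simpa [alV_zero] using this

lemma uniq_forward (d d' : ℝ → ℤ → ℂ) (T B C : ℝ)
    (hB : ∀ t ∈ Set.Icc 0 T, ∀ n, ‖d t n‖ ≤ B)
    (hd : ∀ t ∈ Set.Icc 0 T, ∀ n, HasDerivAt (fun s => d s n) (d' t n) t)
    (h0 : ∀ n, d 0 n = 0)
    (hC : ∀ t ∈ Set.Icc 0 T, ∀ b, (∀ m, ‖d t m‖ ≤ b) → ∀ n, ‖d' t n‖ ≤ C * b) :
    ∀ t ∈ Set.Icc 0 T, ∀ n, d t n = 0 := by
  have key : ∀ k : ℕ, ∀ t ∈ Set.Icc 0 T, ∀ n,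
      ‖d t n‖ ≤ B * ((C * t) ^ k / (k.factorial : ℝ)) := by
    intro k
    induction k with
    | zero => intro t ht n; simpa using hB t ht n
    | succ k ih =>
      intro t ht n
      refine image_norm_le_of_norm_deriv_right_le_deriv_boundary
        (f := fun s => d s n) (f' := fun s => d' s n) (a := 0) (b := T)
        (B := fun s => B * ((C * s) ^ (k + 1) / ((k + 1).factorial : ℝ)))
        (B' := fun s => C * (B * ((C * s) ^ k / (k.factorial : ℝ)))) ?_ ?_ ?_ ?_ ?_ ht
      · intro s hs
        exact (hd s hs n).continuousAt.continuousWithinAt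
      · intro s hs
        exact (hd s ⟨hs.1, hs.2.le⟩ n).hasDerivWithinAt
      · simp [h0]
      · intro s
        have h1 : HasDerivAt (fun s : ℝ => C * s) C s := by
          simpa using (hasDerivAt_id s).const_mul C
        have h2 := ((h1.fun_pow (k + 1)).div_const ((k + 1).factorial : ℝ)).const_mul B
        refine h2.congr_deriv ?_
        rw [Nat.factorial_succ]
        have : (k.factorial : ℝ) ≠ 0 := by positivity
        push_cast
        field_simp
      · intro s hs
        exact hC s ⟨hs.1, hs.2.le⟩ _ (fun m => ih s ⟨hs.1, hs.2.le⟩ m) n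
  intro t ht n
  have hlim : Filter.Tendsto (fun k : ℕ => B * ((C * t) ^ k / (k.factorial : ℝ)))
      Filter.atTop (nhds (B * 0)) :=
    (FloorSemiring.tendsto_pow_div_factorial_atTop (C * t)).const_mul B
  have := ge_of_tendsto' hlim (fun k => key k t ht n)
  simpa using this

lemma al_unique (p q : ℝ → ℤ → ℂ) (T a : ℝ)
    (hp : ∀ t ∈ Set.Icc (-T) T, ∀ n, ‖p t n‖ ≤ a)
    (hq : ∀ t ∈ Set.Icc (-T) T, ∀ n, ‖q t n‖ ≤ a)
    (dp : ∀ t ∈ Set.Icc (-T) T, ∀ n, HasDerivAt (fun s => p s n) (alRHS (p t) n) t)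
    (dq : ∀ t ∈ Set.Icc (-T) T, ∀ n, HasDerivAt (fun s => q s n) (alRHS (q t) n) t)
    (h0 : ∀ n, p 0 n = q 0 n) :
    ∀ t ∈ Set.Icc (-T) T, ∀ n, p t n = q t n := by
  have hbd : ∀ t ∈ Set.Icc (-T) T, ∀ b, (∀ m, ‖p t m - q t m‖ ≤ b) →
      ∀ n, ‖alRHS (p t) n - alRHS (q t) n‖ ≤ ((2 + 4 * a ^ 2) * 3) * b := by
    intro t ht b hb n
    refine (alRHS_diff (p t) (q t) a (hp t ht) (hq t ht) n).trans ?_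
    rw [mul_assoc]
    gcongr
    linarith [hb n, hb (n + 1), hb (n - 1)]
  have hd2 : ∀ t ∈ Set.Icc (-T) T, ∀ n, ‖p t n - q t n‖ ≤ 2 * a := by
    intro t ht n
    linarith [norm_sub_le (p t n) (q t n), hp t ht n, hq t ht n]
  have F := uniq_forward (fun t n => p t n - q t n) (fun t n => alRHS (p t) n - alRHS (q t) n)
    T (2 * a) ((2 + 4 * a ^ 2) * 3)
    (fun t ht => hd2 t ⟨by linarith [ht.1, ht.2], ht.2⟩)
    (fun t ht n => (dp t ⟨by linarith [ht.1, ht.2], ht.2⟩ n).sub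
      (dq t ⟨by linarith [ht.1, ht.2], ht.2⟩ n))
    (fun n => by simp [h0])
    (fun t ht => hbd t ⟨by linarith [ht.1, ht.2], ht.2⟩)
  have G := uniq_forward (fun t n => p (-t) n - q (-t) n)
    (fun t n => -(alRHS (p (-t)) n - alRHS (q (-t)) n))
    T (2 * a) ((2 + 4 * a ^ 2) * 3)
    (fun t ht => hd2 (-t) ⟨by linarith [ht.1, ht.2], by linarith [ht.1, ht.2]⟩)
    (fun t ht n => by
      have h1 : -t ∈ Set.Icc (-T) T := ⟨by linarith [ht.1, ht.2], by linarith [ht.1, ht.2]⟩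
      have h2 := (dp (-t) h1 n).sub (dq (-t) h1 n)
      have h3 := h2.scomp t (hasDerivAt_neg t)
      simpa [Function.comp_def] using h3)
    (fun n => by simp [h0])
    (fun t ht b hb n => by
      have h1 : -t ∈ Set.Icc (-T) T := ⟨by linarith [ht.1, ht.2], by linarith [ht.1, ht.2]⟩
      rw [norm_neg]
      exact hbd (-t) h1 b hb n)
  intro t ht n
  rcases le_total 0 t with h | h
  · exact sub_eq_zero.1 (F t ⟨h, ht.2⟩ n)
  · have := G (-t) ⟨by linarith, by linarith [ht.1]⟩ n
    simp only [neg_neg] at this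
    exact sub_eq_zero.1 this

/-- The flux of the conservation law. -/
noncomputable def flux (q : ℤ → ℂ) (n : ℤ) : ℝ := ((starRingEnd ℂ) (q n) * q (n + 1)).im

lemma flux_le (q : ℤ → ℂ) (n : ℤ) : |flux q n| ≤ ‖q n‖ * ‖q (n + 1)‖ := by
  refine (Complex.abs_im_le_norm _).trans ?_
  rw [norm_mul, Complex.norm_conj]

lemma log_deriv (q : ℝ → ℤ → ℂ) (n : ℤ) (t θ : ℝ)
    (h : HasDerivAt (fun s => q s n) ((θ : ℂ) * alRHS (q t) n) t) :
    HasDerivAt (fun s => Real.log (1 + ‖q s n‖ ^ 2))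
      (2 * θ * (flux (q t) n - flux (q t) (n - 1))) t := by
  have h1 := h.norm_sq.const_add 1
  have hpos : (1 + ‖q t n‖ ^ 2) ≠ 0 := by positivity
  have h2 := h1.log hpos
  convert h2 using 1
  rw [eq_div_iff hpos, Complex.inner]
  have e : ((‖q t n‖ : ℂ)) ^ 2 = ((‖q t n‖ ^ 2 : ℝ) : ℂ) := by push_cast; rfl
  simp only [alRHS, flux, e, Complex.sq_norm, Complex.normSq_apply, sub_add_cancel]
  simp
  ring

lemma sup_bound (q : ℝ → ℤ → ℂ) (θ : ℝ → ℝ) (T C S : ℝ) (hT : 0 ≤ T)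
    (hθ : ∀ t, |θ t| ≤ 1)
    (dq : ∀ t ∈ Set.Icc (-T) T, ∀ n,
      HasDerivAt (fun s => q s n) ((θ t : ℂ) * alRHS (q t) n) t)
    (hC : ∀ t ∈ Set.Icc (-T) T, ∀ n, wt n * ‖q t n‖ ≤ C)
    (hS : ∀ s : Finset ℤ, ∑ n ∈ s, ‖q 0 n‖ ^ 2 ≤ S) :
    ∀ t ∈ Set.Icc (-T) T, ∀ n, ‖q t n‖ ^ 2 ≤ Real.exp (S + 1) := by
  intro t ht n
  have h0T : (0 : ℝ) ∈ Set.Icc (-T) T := ⟨by linarith, hT⟩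
  have hC0 : 0 ≤ C := le_trans (by have := wt_pos 0; positivity) (hC 0 h0T 0)
  obtain ⟨N, hN⟩ := exists_nat_ge (4 * C ^ 2 * T + |(n : ℝ)| + 1)
  have hN1 : (0 : ℝ) < N := by
    have : 0 ≤ 4 * C ^ 2 * T := by positivity
    linarith [abs_nonneg (n : ℝ)]
  have hNn : |n| ≤ (N : ℤ) := by
    have : |(n : ℝ)| ≤ N := by
      have : 0 ≤ 4 * C ^ 2 * T := by positivity
      linarith
    exact_mod_cast this
  -- partial sums
  have dE : ∀ s ∈ Set.Icc (-T) T, HasDerivAt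
      (fun s => ∑ k ∈ Finset.range (2 * N + 1), Real.log (1 + ‖q s ((k : ℤ) - N)‖ ^ 2))
      (2 * θ s * (flux (q s) N - flux (q s) (-(N : ℤ) - 1))) s := by
    intro s hs
    have h := HasDerivAt.fun_sum (u := Finset.range (2 * N + 1))
      (fun k _ => log_deriv q ((k : ℤ) - N) s (θ s) (dq s hs _))
    refine h.congr_deriv ?_
    rw [← Finset.mul_sum]
    congr 1
    have h1 := Finset.sum_range_sub (fun k : ℕ => flux (q s) ((k : ℤ) - N - 1)) (2 * N + 1)
    have h2 : ∀ k : ℕ, (((k + 1 : ℕ) : ℤ) - N - 1) = (k : ℤ) - N := by intro k; push_cast; ring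
    simp only [h2] at h1
    rw [h1]
    congr 2
    · push_cast; ring
    · push_cast; ring
  have hflux : ∀ s ∈ Set.Icc (-T) T, ∀ m : ℤ, (N : ℝ) ≤ |(m : ℝ)| →
      |flux (q s) m| ≤ C ^ 2 / N := by
    intro s hs m hm
    have h1 := hC s hs m
    have h2 := hC s hs (m + 1)
    have h3 := one_le_wt (m + 1)
    have h4 := hm.trans (abs_le_wt m)
    have h5 : ‖q s (m + 1)‖ ≤ C := by nlinarith [norm_nonneg (q s (m + 1))]
    have h6 : ‖q s m‖ ≤ C / N := by
      rw [le_div_iff₀ hN1]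
      nlinarith [norm_nonneg (q s m)]
    calc _ ≤ _ := flux_le _ _
      _ ≤ C / N * C := by gcongr
      _ = _ := by ring
  have hbound : ∀ s ∈ Set.Icc (-T) T,
      ‖2 * θ s * (flux (q s) N - flux (q s) (-(N : ℤ) - 1))‖ ≤ 4 * C ^ 2 / N := by
    intro s hs
    have h1 := hflux s hs N (by simp)
    have h2 := hflux s hs (-(N : ℤ) - 1) (by
      push_cast
      rw [abs_of_nonpos (by linarith)]; linarith)
    rw [Real.norm_eq_abs, abs_mul, abs_mul, abs_two]
    calc _ ≤ 2 * 1 * (C ^ 2 / N + C ^ 2 / N) := by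
          gcongr
          · exact hθ s
          · exact (abs_sub _ _).trans (add_le_add h1 h2)
      _ = _ := by ring
  have hmv := (convex_Icc (-T) T).norm_image_sub_le_of_norm_hasDerivWithin_le
    (fun s hs => (dE s hs).hasDerivWithinAt) hbound h0T ht
  have htT : ‖t - 0‖ ≤ T := by
    rw [sub_zero, Real.norm_eq_abs]; exact abs_le.2 ht
  have h1 : 4 * C ^ 2 / N * ‖t - 0‖ ≤ 1 := by
    calc _ ≤ 4 * C ^ 2 / N * T := by gcongr
      _ = (4 * C ^ 2 * T) / N := by ring
      _ ≤ 1 := by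
        rw [div_le_one hN1]
        linarith [abs_nonneg (n : ℝ)]
  have hE0 : ∑ k ∈ Finset.range (2 * N + 1), Real.log (1 + ‖q 0 ((k : ℤ) - N)‖ ^ 2) ≤ S := by
    have hinj : Set.InjOn (fun k : ℕ => (k : ℤ) - N) (Finset.range (2 * N + 1) : Finset ℕ) := by
      intro a _ b _ hab
      simpa using hab
    have h2 := hS ((Finset.range (2 * N + 1)).image (fun k : ℕ => (k : ℤ) - N))
    rw [Finset.sum_image hinj] at h2
    refine le_trans (Finset.sum_le_sum fun k _ => ?_) h2
    have := Real.log_le_sub_one_of_pos (show 0 < 1 + ‖q 0 ((k : ℤ) - N)‖ ^ 2 by positivity)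
    linarith
  have hEt : ∑ k ∈ Finset.range (2 * N + 1), Real.log (1 + ‖q t ((k : ℤ) - N)‖ ^ 2) ≤ S + 1 := by
    have := (le_abs_self _).trans (hmv.trans h1)
    linarith
  have hn : Real.log (1 + ‖q t n‖ ^ 2) ≤ S + 1 := by
    refine le_trans ?_ hEt
    have hk := abs_le.1 hNn
    have h3 := Finset.single_le_sum (s := Finset.range (2 * N + 1))
      (f := fun k : ℕ => Real.log (1 + ‖q t ((k : ℤ) - N)‖ ^ 2))
      (fun k _ => Real.log_nonneg (by nlinarith [sq_nonneg ‖q t ((k : ℤ) - N)‖]))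
      (a := (n + N).toNat) (by rw [Finset.mem_range]; omega)
    have h4 : (((n + N).toNat : ℕ) : ℤ) - N = n := by omega
    simpa only [h4] using h3
  have := (Real.log_le_iff_le_exp (by positivity)).1 hn
  linarith

section abstractODE

set_option linter.unusedSectionVars false

variable {E : Type*} [NormedAddCommGroup E] [NormedSpace ℝ E]

/-- The radial cutoff. -/
noncomputable def cutoff (ρ : ℝ) (x : E) : ℝ := max 0 (min 1 (ρ + 1 - ‖x‖))

lemma cutoff_nonneg (ρ : ℝ) (x : E) : 0 ≤ cutoff ρ x := le_max_left _ _

lemma cutoff_le_one (ρ : ℝ) (x : E) : cutoff ρ x ≤ 1 :=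
  max_le zero_le_one (min_le_left _ _)

lemma cutoff_eq_one (ρ : ℝ) (x : E) (h : ‖x‖ ≤ ρ) : cutoff ρ x = 1 := by
  rw [cutoff, min_eq_left (by linarith), max_eq_right zero_le_one]

lemma cutoff_eq_zero (ρ : ℝ) (x : E) (h : ρ + 1 ≤ ‖x‖) : cutoff ρ x = 0 := by
  rw [cutoff, max_eq_left]
  exact (min_le_right _ _).trans (by linarith)

lemma cutoff_lip (ρ : ℝ) (x y : E) : |cutoff ρ x - cutoff ρ y| ≤ ‖x - y‖ := by
  unfold cutoff
  have h1 := abs_max_sub_max_le_abs (min 1 (ρ + 1 - ‖x‖)) (min 1 (ρ + 1 - ‖y‖)) 0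
  have h2 := abs_min_sub_min_le_max 1 (ρ + 1 - ‖x‖) 1 (ρ + 1 - ‖y‖)
  have h3 : |(ρ + 1 - ‖x‖) - (ρ + 1 - ‖y‖)| ≤ ‖x - y‖ := by
    have := abs_norm_sub_norm_le y x
    rw [norm_sub_rev] at this
    convert this using 2
    ring
  have h4 : max |(1 : ℝ) - 1| |(ρ + 1 - ‖x‖) - (ρ + 1 - ‖y‖)| ≤ ‖x - y‖ := by
    apply max_le _ h3
    simp
  rw [max_comm (0 : ℝ), max_comm (0 : ℝ)]
  exact h1.trans (h2.trans h4)

lemma trunc_exist [CompleteSpace E] (V : E → E)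
    (hV : ∀ r : ℝ, ∃ K : ℝ, 0 ≤ K ∧ ∀ x y, ‖x‖ ≤ r → ‖y‖ ≤ r → ‖V x - V y‖ ≤ K * ‖x - y‖)
    (x0 : E) (ρ T : ℝ) (hρ : 0 ≤ ρ) (hT : 0 ≤ T) :
    ∃ x : ℝ → E, x 0 = x0 ∧
      ∀ t ∈ Set.Icc (-T) T, HasDerivAt x (cutoff ρ (x t) • V (x t)) t := by
  have hbd : ∀ r : ℝ, 0 ≤ r → ∃ B : ℝ, 0 ≤ B ∧ ∀ x, ‖x‖ ≤ r → ‖V x‖ ≤ B := by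
    intro r hr
    obtain ⟨K, hK, h⟩ := hV r
    refine ⟨K * r + ‖V 0‖, by positivity, fun x hx => ?_⟩
    have h1 := h x 0 hx (by simpa using hr)
    have h2 := norm_le_norm_sub_add (V x) (V 0)
    have h3 : K * ‖x - 0‖ ≤ K * r := by rw [sub_zero]; gcongr
    linarith
  obtain ⟨L, hL, hLb⟩ := hbd (ρ + 1) (by linarith)
  have ha : 0 ≤ L * (T + 1) := by positivity
  obtain ⟨B, hB, hBb⟩ := hbd (‖x0‖ + L * (T + 1)) (by positivity)
  obtain ⟨K, hK, hKb⟩ := hV (‖x0‖ + L * (T + 1))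
  have h0 : (0 : ℝ) ∈ Set.Icc (-(T + 1)) (T + 1) := ⟨by linarith, by linarith⟩
  have hball : ∀ x ∈ Metric.closedBall x0 (L * (T + 1)), ‖x‖ ≤ ‖x0‖ + L * (T + 1) := by
    intro x hx
    rw [mem_closedBall_iff_norm] at hx
    linarith [norm_le_norm_sub_add x x0]
  have hpl : IsPicardLindelof (fun _ x => cutoff ρ x • V x)
      (⟨0, h0⟩ : Set.Icc (-(T + 1)) (T + 1)) x0
      ⟨L * (T + 1), ha⟩ 0 ⟨L, hL⟩ ⟨K + B, by positivity⟩ := by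
    apply IsPicardLindelof.of_time_independent
    · intro x _
      rw [norm_smul, Real.norm_of_nonneg (cutoff_nonneg ρ x)]
      show _ ≤ L
      rcases le_total (ρ + 1) ‖x‖ with h | h
      · rw [cutoff_eq_zero ρ x h, zero_mul]; exact hL
      · calc _ ≤ 1 * L := by
              gcongr
              · exact cutoff_le_one ρ x
              · exact hLb x h
          _ = L := one_mul L
    · apply LipschitzOnWith.of_dist_le_mul
      intro x hx y hy
      have hx' := hball x hx
      have hy' := hball y hy
      rw [dist_eq_norm, dist_eq_norm]
      show _ ≤ (K + B) * _
      have e : cutoff ρ x • V x - cutoff ρ y • V y =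
          cutoff ρ x • (V x - V y) + (cutoff ρ x - cutoff ρ y) • V y := by
        rw [smul_sub, sub_smul]; abel
      rw [e]
      refine (norm_add_le _ _).trans ?_
      rw [norm_smul, norm_smul, Real.norm_of_nonneg (cutoff_nonneg ρ x), Real.norm_eq_abs]
      calc _ ≤ 1 * (K * ‖x - y‖) + ‖x - y‖ * B := by
            gcongr
            · exact cutoff_le_one ρ x
            · exact hKb x y hx' hy'
            · exact cutoff_lip ρ x y
            · exact hBb y hy'
        _ = _ := by ring
    · show L * max (T + 1 - 0) (0 - -(T + 1)) ≤ L * (T + 1) - 0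
      rw [sub_zero, sub_zero, zero_sub, neg_neg, max_self]
  obtain ⟨x, hx0, hx⟩ := hpl.exists_eq_forall_mem_Icc_hasDerivWithinAt₀
  refine ⟨x, hx0, fun t ht => ?_⟩
  exact (hx t ⟨by linarith [ht.1], by linarith [ht.2]⟩).hasDerivAt
    (Icc_mem_nhds (by linarith [ht.1]) (by linarith [ht.2]))

lemma growth (x f : ℝ → E) (T K : ℝ) (hK : 0 ≤ K)
    (hx : ∀ t ∈ Set.Icc (-T) T, HasDerivAt x (f t) t)
    (hf : ∀ t ∈ Set.Icc (-T) T, ‖f t‖ ≤ K * ‖x t‖) :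
    ∀ t ∈ Set.Icc (-T) T, ‖x t‖ ≤ ‖x 0‖ * Real.exp (K * T) := by
  have F : ∀ (y g : ℝ → E), (∀ t ∈ Set.Icc 0 T, HasDerivAt y (g t) t) →
      (∀ t ∈ Set.Icc 0 T, ‖g t‖ ≤ K * ‖y t‖) →
      ∀ t ∈ Set.Icc 0 T, ‖y t‖ ≤ ‖y 0‖ * Real.exp (K * T) := by
    intro y g hy hg t ht
    have h := norm_le_gronwallBound_of_norm_deriv_right_le (f := y) (f' := g) (δ := ‖y 0‖)
      (K := K) (ε := 0) (a := 0) (b := T)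
      (fun s hs => (hy s hs).continuousAt.continuousWithinAt)
      (fun s hs => (hy s ⟨hs.1, hs.2.le⟩).hasDerivWithinAt) le_rfl
      (fun s hs => by simpa using hg s ⟨hs.1, hs.2.le⟩) t ht
    rw [gronwallBound_ε0, sub_zero] at h
    refine h.trans ?_
    have := ht.2
    gcongr
  intro t ht
  rcases le_total 0 t with h | h
  · exact F x f (fun s hs => hx s ⟨by linarith [hs.1, hs.2], hs.2⟩)
      (fun s hs => hf s ⟨by linarith [hs.1, hs.2], hs.2⟩) t ⟨h, ht.2⟩
  · have := F (fun s => x (-s)) (fun s => -f (-s))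
      (fun s hs => by
        have h1 : -s ∈ Set.Icc (-T) T := ⟨by linarith [hs.1, hs.2], by linarith [hs.1, hs.2]⟩
        have h3 := (hx (-s) h1).scomp s (hasDerivAt_neg s)
        simpa [Function.comp_def] using h3)
      (fun s hs => by
        have h1 : -s ∈ Set.Icc (-T) T := ⟨by linarith [hs.1, hs.2], by linarith [hs.1, hs.2]⟩
        rw [norm_neg]
        exact hf (-s) h1)
      (-t) ⟨by linarith, by linarith [ht.1]⟩
    simpa using this

end abstractODE

lemma qof_hasDerivAt (x : ℝ → ALE) (v : ALE) (t : ℝ) (h : HasDerivAt x v t) (n : ℤ) :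
    HasDerivAt (fun s => qof (x s) n) (qof v n) t := by
  have h1 : HasDerivAt (fun s => x s n) (v n) t :=
    (lp.evalCLM ℝ (fun _ : ℤ => ℂ) 2 n).hasFDerivAt.comp_hasDerivAt t h
  exact h1.div_const _

lemma qof_smul_alV (c : ℝ) (x : ALE) (n : ℤ) :
    qof (c • alV x) n = (c : ℂ) * alRHS (qof x) n := by
  have : (wt n : ℂ) ≠ 0 := by exact_mod_cast (wt_pos n).ne'
  have h : (c • alV x) n = (c : ℂ) * ((wt n : ℂ) * alRHS (qof x) n) := by
    rw [lp.coeFn_smul, Pi.smul_apply, alV_apply, Complex.real_smul]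
  rw [qof, h]
  field_simp

lemma qof_alV (x : ALE) (n : ℤ) : qof (alV x) n = alRHS (qof x) n := by
  have := qof_smul_alV 1 x n
  simpa using this

lemma alV_locLip (r : ℝ) :
    ∃ K : ℝ, 0 ≤ K ∧ ∀ x y : ALE, ‖x‖ ≤ r → ‖y‖ ≤ r → ‖alV x - alV y‖ ≤ K * ‖x - y‖ :=
  ⟨3 * (4 + 8 * r ^ 2), by positivity, fun x y hx hy =>
    alV_diff x y r (fun n => (qof_le x n).trans hx) (fun n => (qof_le y n).trans hy)⟩

lemma exists_bound_Icc (x : ℝ → ALE) (a b : ℝ) (h : ∀ t ∈ Set.Icc a b, ContinuousAt x t) :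
    ∃ C : ℝ, ∀ t ∈ Set.Icc a b, ‖x t‖ ≤ C :=
  isCompact_Icc.exists_bound_of_continuousOn (fun t ht => (h t ht).continuousWithinAt)

lemma local_exist (x0 : ALE) (T : ℝ) (hT : 0 ≤ T) :
    ∃ x : ℝ → ALE, x 0 = x0 ∧ ∀ t ∈ Set.Icc (-T) T, HasDerivAt x (alV (x t)) t := by
  set M : ℝ := Real.exp (‖x0‖ ^ 2 + 1) with hM
  have hM0 : 0 ≤ M := (Real.exp_pos _).le
  set K : ℝ := 3 * (4 + 8 * (Real.sqrt M) ^ 2) with hK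
  have hK0 : 0 ≤ K := by positivity
  obtain ⟨x, hx0, hx⟩ := trunc_exist alV alV_locLip x0 (‖x0‖ * Real.exp (K * T)) T
    (by positivity) hT
  set ρ : ℝ := ‖x0‖ * Real.exp (K * T) with hρ
  obtain ⟨C, hC⟩ := exists_bound_Icc x (-T) T (fun t ht => (hx t ht).continuousAt)
  have hsup := sup_bound (fun t => qof (x t)) (fun t => cutoff ρ (x t)) T C (‖x0‖ ^ 2) hT
    (fun t => by rw [abs_of_nonneg (cutoff_nonneg _ _)]; exact cutoff_le_one _ _)
    (fun t ht n => by
      have := qof_hasDerivAt x _ t (hx t ht) n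
      rwa [qof_smul_alV] at this)
    (fun t ht n => by
      rw [wt_mul_qof]
      exact (ale_apply_le _ _).trans (hC t ht))
    (fun s => by
      rw [hx0]
      have h1 := ale_hasSum x0
      refine le_trans (Finset.sum_le_sum fun n _ => ?_)
        (sum_le_hasSum s (fun n _ => sq_nonneg ‖x0 n‖) h1)
      have h2 := wt_mul_qof x0 n
      have h3 := one_le_wt n
      have h4 : ‖qof x0 n‖ ≤ ‖x0 n‖ := by nlinarith [norm_nonneg (qof x0 n)]
      gcongr)
  have hg := growth x (fun t => cutoff ρ (x t) • alV (x t)) T K hK0 hx (fun t ht => by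
    rw [norm_smul, Real.norm_of_nonneg (cutoff_nonneg _ _)]
    have h1 := alV_le (x t) (Real.sqrt M) (fun n => Real.le_sqrt_of_sq_le (hsup t ht n))
    calc _ ≤ 1 * ‖alV (x t)‖ := by gcongr; exact cutoff_le_one _ _
      _ = ‖alV (x t)‖ := one_mul _
      _ ≤ _ := h1)
  refine ⟨x, hx0, fun t ht => ?_⟩
  have h1 := hg t ht
  rw [hx0] at h1
  have h2 := hx t ht
  rwa [cutoff_eq_one ρ (x t) h1, one_smul] at h2

lemma ale_unique (x y : ℝ → ALE) (T : ℝ) (h0 : x 0 = y 0)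
    (hx : ∀ t ∈ Set.Icc (-T) T, HasDerivAt x (alV (x t)) t)
    (hy : ∀ t ∈ Set.Icc (-T) T, HasDerivAt y (alV (y t)) t) :
    ∀ t ∈ Set.Icc (-T) T, x t = y t := by
  obtain ⟨C, hC⟩ := exists_bound_Icc x (-T) T (fun t ht => (hx t ht).continuousAt)
  obtain ⟨D, hD⟩ := exists_bound_Icc y (-T) T (fun t ht => (hy t ht).continuousAt)
  have h := al_unique (fun t => qof (x t)) (fun t => qof (y t)) T (max C D)
    (fun t ht n => (qof_le _ _).trans ((hC t ht).trans (le_max_left _ _)))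
    (fun t ht n => (qof_le _ _).trans ((hD t ht).trans (le_max_right _ _)))
    (fun t ht n => by rw [← qof_alV]; exact qof_hasDerivAt x _ t (hx t ht) n)
    (fun t ht n => by rw [← qof_alV]; exact qof_hasDerivAt y _ t (hy t ht) n)
    (fun n => by simp only [h0])
  intro t ht
  ext n
  have h1 := h t ht n
  have : (wt n : ℂ) ≠ 0 := by exact_mod_cast (wt_pos n).ne'
  simp only [qof] at h1
  exact (div_left_inj' this).1 h1

lemma global_exist (x0 : ALE) :
    ∃ x : ℝ → ALE, x 0 = x0 ∧ ∀ t, HasDerivAt x (alV (x t)) t := by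
  choose! Y hY0 hY using fun T : ℝ => local_exist x0 T
  have cons : ∀ S T s : ℝ, |s| ≤ S → |s| ≤ T → Y S s = Y T s := by
    intro S T s hS hT
    have h1 : 0 ≤ S := (abs_nonneg s).trans hS
    have h2 : 0 ≤ T := (abs_nonneg s).trans hT
    refine ale_unique (Y S) (Y T) |s| (by rw [hY0 S h1, hY0 T h2])
      (fun t ht => hY S h1 t ⟨by linarith [ht.1], by linarith [ht.2]⟩)
      (fun t ht => hY T h2 t ⟨by linarith [ht.1], by linarith [ht.2]⟩) s (abs_le.1 le_rfl)
  refine ⟨fun t => Y |t| t, by simpa using hY0 0 le_rfl, fun t => ?_⟩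
  have hpos : 0 ≤ |t| + 1 := by positivity
  have h1 := hY (|t| + 1) hpos t (abs_le.1 (by linarith))
  have hev : (fun s => Y |s| s) =ᶠ[nhds t] Y (|t| + 1) := by
    filter_upwards [Metric.ball_mem_nhds t one_pos] with s hs
    apply cons _ _ _ le_rfl
    rw [Metric.mem_ball, Real.dist_eq] at hs
    have := abs_sub_abs_le_abs_sub s t
    linarith
  have h2 := h1.congr_of_eventuallyEq hev
  rwa [← hev.eq_of_nhds] at h2

/-- Global well-posedness of the focusing Ablowitz–Ladik initial-value problem in
ℓ^{2,1}: existence of a global solution, uniqueness among continuous ℓ^∞-valued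
curves solving the system componentwise, and Lipschitz continuity on compact
intervals. -/
theorem ablowitz_ladik_global_wellposedness
    (q0 : ℤ → ℂ)
    (hq0 : Summable fun n : ℤ => (1 + (n : ℝ) ^ 2) * ‖q0 n‖ ^ 2) :
    ∃ q : ℝ → ℤ → ℂ,
      -- the solution stays in ℓ^{2,1}
      (∀ t : ℝ, Summable fun n : ℤ => (1 + (n : ℝ) ^ 2) * ‖q t n‖ ^ 2) ∧
      -- initial condition
      (∀ n : ℤ, q 0 n = q0 n) ∧
      -- the focusing Ablowitz–Ladik system, i q'_n = q_{n+1} - 2q_n + q_{n-1} + |q_n|²(q_{n+1}+q_{n-1})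
      (∀ (n : ℤ) (t : ℝ), HasDerivAt (fun s : ℝ => q s n) (alRHS (q t) n) t) ∧
      -- uniqueness among continuous curves into ℓ^∞ with differentiable components solving the system
      (∀ p : ℝ → lp (fun _ : ℤ => ℂ) ∞,
        Continuous p →
        (∀ n : ℤ, p 0 n = q0 n) →
        (∀ (n : ℤ) (t : ℝ), HasDerivAt (fun s : ℝ => p s n) (alRHS (fun m => p t m) n) t) →
        ∀ (t : ℝ) (n : ℤ), p t n = q t n) ∧
      -- Lipschitz continuity into ℓ^{2,1} on every compact interval
      (∀ a b : ℝ, ∃ L : ℝ, ∀ s ∈ Set.Icc a b, ∀ t ∈ Set.Icc a b,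
        norm21 (fun n => q s n - q t n) ≤ L * |s - t|) := by
  have hsq : ∀ (x : ALE) (n : ℤ), (1 + (n : ℝ) ^ 2) * ‖qof x n‖ ^ 2 = ‖x n‖ ^ 2 := by
    intro x n
    rw [← wt_mul_qof, mul_pow, wt_sq]
  have hmem : Memℓp (E := fun _ : ℤ => ℂ) (fun n => (wt n : ℂ) * q0 n) 2 := by
    apply ale_mem
    refine hq0.congr (fun n => ?_)
    rw [norm_mul, Complex.norm_real, Real.norm_of_nonneg (wt_pos n).le, mul_pow, wt_sq]
  obtain ⟨x, hx0, hx⟩ := global_exist ⟨fun n => (wt n : ℂ) * q0 n, hmem⟩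
  have hinit : ∀ n : ℤ, qof (x 0) n = q0 n := by
    intro n
    have : (wt n : ℂ) ≠ 0 := by exact_mod_cast (wt_pos n).ne'
    rw [hx0, qof]
    exact mul_div_cancel_left₀ _ this
  have hder : ∀ (n : ℤ) (t : ℝ), HasDerivAt (fun s : ℝ => qof (x s) n) (alRHS (qof (x t)) n) t := by
    intro n t
    rw [← qof_alV]
    exact qof_hasDerivAt x _ t (hx t) n
  have hcont : ∀ t, ContinuousAt x t := fun t => (hx t).continuousAt
  refine ⟨fun t => qof (x t), fun t => ?_, hinit, hder, ?_, ?_⟩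
  · refine (ale_hasSum (x t)).summable.congr (fun n => ?_)
    rw [hsq]
  · intro p hp hp0 hpd t n
    obtain ⟨C, hC⟩ := exists_bound_Icc x (-|t|) |t| (fun t _ => hcont t)
    obtain ⟨D, hD⟩ := (isCompact_Icc (a := -|t|) (b := |t|)).exists_bound_of_continuousOn
      hp.continuousOn
    exact al_unique (fun t n => p t n) (fun t => qof (x t)) |t| (max C D)
      (fun s hs n => (lp.norm_apply_le_norm (by simp) _ _).trans
        ((hD s hs).trans (le_max_right _ _)))
      (fun s hs n => (qof_le _ _).trans ((hC s hs).trans (le_max_left _ _)))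
      (fun s _ n => hpd n s) (fun s _ n => hder n s)
      (fun n => by rw [hp0, hinit]) t (abs_le.1 le_rfl) n
  · intro a b
    obtain ⟨C, hC⟩ := exists_bound_Icc x a b (fun t _ => hcont t)
    refine ⟨3 * (4 + 8 * C ^ 2) * C, fun s hs t ht => ?_⟩
    have h1 : norm21 (fun n => qof (x s) n - qof (x t) n) = ‖x s - x t‖ := by
      rw [norm21]
      simp only [← qof_sub, hsq]
      rw [(ale_hasSum (x s - x t)).tsum_eq, Real.sqrt_sq (norm_nonneg _)]
    have h2 := (convex_Icc a b).norm_image_sub_le_of_norm_hasDerivWithin_le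
      (f := x) (f' := fun t => alV (x t)) (C := 3 * (4 + 8 * C ^ 2) * C)
      (fun u _ => (hx u).hasDerivWithinAt)
      (fun u hu => by
        have h3 := alV_le (x u) C (fun n => (qof_le _ _).trans (hC u hu))
        refine h3.trans ?_
        have := hC u hu
        gcongr) ht hs
    simp only [h1]
    exact h2
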